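/- For n = 2 agents and m = 5 objects: (i) for every real α with 1/5 < α ≤ 3/11, every v ∈ V(α; 5) satisfies MMS_2(v) ≤ (3 − 3α)/4 and there exists v ∈ V(α; 5) with MMS_2(v) = (3 − 3α)/4; (ii) for every real α with 3/11 < α ≤ 1/3, every v ∈ V(α; 5) satisfies MMS_2(v) ≤ 2α and there exists v ∈ V(α; 5) with MMS_2(v) = 2α. -/

import Mathlib

open Finset

/-- A (normalised, additive) disutility function on `m` objects. -/
def IsDisutility (m : ℕ) (v : Fin m → ℝ) : Prop :=
  (∀ e, 0 ≤ v e) ∧ ∑ e, v e = 1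

/-- The MinMaxShare of `v` among `n` agents: the minimum over allocations
`A : Fin m → Fin n` of the maximum bundle disutility. -/
noncomputable def MMS (n m : ℕ) (v : Fin m → ℝ) : ℝ :=
  ⨅ A : Fin m → Fin n, ⨆ j : Fin n, ∑ e ∈ Finset.univ.filter (fun e => A e = j), v e

/-- `v ∈ V(α;m)`: a disutility function on `m` objects whose maximum single-object
value equals `α`. -/
def Vmem (α : ℝ) (m : ℕ) (v : Fin m → ℝ) : Prop :=
  IsDisutility m v ∧ (⨆ e, v e) = α

theorem MMS_le_of_allocation {n m : ℕ} [NeZero n] {v : Fin m → ℝ} {c : ℝ} (A : Fin m → Fin n)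
    (h : ∀ j, ∑ e ∈ Finset.univ.filter (fun e => A e = j), v e ≤ c) : MMS n m v ≤ c :=
  (ciInf_le (Set.finite_range _).bddBelow A).trans (ciSup_le h)

theorem le_MMS_of_forall_exists {n m : ℕ} [NeZero n] {v : Fin m → ℝ} {c : ℝ}
    (h : ∀ A : Fin m → Fin n, ∃ j, c ≤ ∑ e ∈ Finset.univ.filter (fun e => A e = j), v e) :
    c ≤ MMS n m v :=
  le_ciInf fun A => (h A).elim fun j hj =>
    hj.trans (le_ciSup (f := fun j => ∑ e ∈ Finset.univ.filter (fun e => A e = j), v e)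
      (Set.finite_range _).bddAbove j)

/-- Give one agent a largest object together with a largest remaining one. -/
theorem MMS_two_five_le_max {α : ℝ} {v : Fin 5 → ℝ} (hv : Vmem α 5 v) :
    MMS 2 5 v ≤ max (2 * α) ((3 - 3 * α) / 4) := by
  obtain ⟨⟨-, hsum⟩, hsup⟩ := hv
  have hle : ∀ e, v e ≤ α := fun e => hsup ▸ le_ciSup (Set.finite_range v).bddAbove e
  obtain ⟨i, hi⟩ : ∃ i, v i = α := hsup ▸ exists_eq_ciSup_of_finite
  have herase : ∑ e ∈ univ.erase i, v e = 1 - α := by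
    rw [← hsum, ← hi, ← Finset.sum_erase_add _ _ (mem_univ i)]
    ring
  obtain ⟨j, hj, hvj⟩ : ∃ j ∈ univ.erase i, (1 - α) / 4 ≤ v j := by
    by_contra! hlt
    have hcard : (univ.erase i).card = 4 := by simp
    have hlt' := Finset.sum_lt_sum_of_nonempty (Finset.card_pos.mp (by omega)) hlt
    rw [herase, Finset.sum_const, hcard, nsmul_eq_mul] at hlt'
    push_cast at hlt'
    linarith
  have hne : j ≠ i := Finset.ne_of_mem_erase hj
  have hpair : ∑ e ∈ ({i, j} : Finset (Fin 5)), v e = v i + v j := Finset.sum_pair hne.symm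
  have hcompl := Finset.sum_add_sum_compl ({i, j} : Finset (Fin 5)) v
  refine MMS_le_of_allocation (fun e => if e ∈ ({i, j} : Finset (Fin 5)) then 0 else 1) ?_
  rw [Fin.forall_fin_two]
  constructor
  · have hset : univ.filter (fun e => (if e ∈ ({i, j} : Finset (Fin 5)) then (0 : Fin 2) else 1) = 0)
        = {i, j} := by
      ext e
      simp [or_iff_not_imp_left]
    rw [hset, hpair]
    exact le_max_of_le_left (by linarith [hle j])
  · have hset : univ.filter (fun e => (if e ∈ ({i, j} : Finset (Fin 5)) then (0 : Fin 2) else 1) = 1)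
        = {i, j}ᶜ := by
      ext e
      simp
    rw [hset]
    exact le_max_of_le_right (by linarith)

theorem Vmem_vec_five {a b c d e : ℝ} (hb : 0 ≤ b) (hc : 0 ≤ c) (hd : 0 ≤ d) (he : 0 ≤ e)
    (hba : b ≤ a) (hca : c ≤ a) (hda : d ≤ a) (hea : e ≤ a) (hsum : a + b + c + d + e = 1) :
    Vmem a 5 ![a, b, c, d, e] := by
  refine ⟨⟨?_, ?_⟩, le_antisymm (ciSup_le ?_) ?_⟩
  · simp [Fin.forall_fin_succ, hb, hc, hd, he, hb.trans hba]
  · simpa [Fin.sum_univ_five] using hsum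
  · simp [Fin.forall_fin_succ, hba, hca, hda, hea]
  · exact le_ciSup (f := ![a, b, c, d, e]) (Set.finite_range _).bddAbove 0

/-- One of the two agents receives at least three objects. -/
theorem le_MMS_two_five_of_four_equal {a b : ℝ} (hb : 0 ≤ b) (hba : b ≤ a) :
    3 * b ≤ MMS 2 5 ![a, b, b, b, b] := by
  refine le_MMS_of_forall_exists fun A => ?_
  rw [Fin.exists_fin_two]
  simp only [Finset.sum_filter, Fin.sum_univ_five]
  have h2 : ∀ x : Fin 2, x = 0 ∨ x = 1 := by decide
  rcases h2 (A 0) with h0 | h0 <;> rcases h2 (A 1) with h1 | h1 <;>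
    rcases h2 (A 2) with h2' | h2' <;> rcases h2 (A 3) with h3 | h3 <;>
    rcases h2 (A 4) with h4 | h4 <;> simp [h0, h1, h2', h3, h4] <;>
    first
    | (left; linarith)
    | (right; linarith)

/-- One of the two agents receives at least two of the three largest objects. -/
theorem le_MMS_two_five_of_three_equal {a c : ℝ} (ha : 0 ≤ a) (hc : 0 ≤ c) :
    2 * a ≤ MMS 2 5 ![a, a, a, c, c] := by
  refine le_MMS_of_forall_exists fun A => ?_
  rw [Fin.exists_fin_two]
  simp only [Finset.sum_filter, Fin.sum_univ_five]
  have h2 : ∀ x : Fin 2, x = 0 ∨ x = 1 := by decide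
  rcases h2 (A 0) with h0 | h0 <;> rcases h2 (A 1) with h1 | h1 <;>
    rcases h2 (A 2) with h2' | h2' <;> rcases h2 (A 3) with h3 | h3 <;>
    rcases h2 (A 4) with h4 | h4 <;> simp [h0, h1, h2', h3, h4] <;>
    first
    | (left; linarith)
    | (right; linarith)

theorem stmt10 :
    (∀ α : ℝ, 1/5 < α → α ≤ 3/11 →
      (∀ v : Fin 5 → ℝ, Vmem α 5 v → MMS 2 5 v ≤ (3 - 3*α)/4) ∧
      (∃ v : Fin 5 → ℝ, Vmem α 5 v ∧ MMS 2 5 v = (3 - 3*α)/4)) ∧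
    (∀ α : ℝ, 3/11 < α → α ≤ 1/3 →
      (∀ v : Fin 5 → ℝ, Vmem α 5 v → MMS 2 5 v ≤ 2*α) ∧
      (∃ v : Fin 5 → ℝ, Vmem α 5 v ∧ MMS 2 5 v = 2*α)) := by
  refine ⟨fun α h1 h2 => ?_, fun α h1 h2 => ?_⟩
  · have upper : ∀ v : Fin 5 → ℝ, Vmem α 5 v → MMS 2 5 v ≤ (3 - 3*α)/4 := fun v hv =>
      (MMS_two_five_le_max hv).trans (max_le (by linarith) le_rfl)
    have hmem : Vmem α 5 ![α, (1 - α)/4, (1 - α)/4, (1 - α)/4, (1 - α)/4] := by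
      apply Vmem_vec_five <;> linarith
    have hlow : 3 * ((1 - α)/4) ≤ MMS 2 5 ![α, (1 - α)/4, (1 - α)/4, (1 - α)/4, (1 - α)/4] :=
      le_MMS_two_five_of_four_equal (by linarith) (by linarith)
    exact ⟨upper, _, hmem, le_antisymm (upper _ hmem) (by linarith)⟩
  · have upper : ∀ v : Fin 5 → ℝ, Vmem α 5 v → MMS 2 5 v ≤ 2*α := fun v hv =>
      (MMS_two_five_le_max hv).trans (max_le le_rfl (by linarith))
    have hmem : Vmem α 5 ![α, α, α, (1 - 3*α)/2, (1 - 3*α)/2] := by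
      apply Vmem_vec_five <;> linarith
    exact ⟨upper, _, hmem, le_antisymm (upper _ hmem)
      (le_MMS_two_five_of_three_equal (by linarith) (by linarith))⟩
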